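/- Every kG-module endomorphism of V₊ is a scalar multiple of the identity, i.e., End_{kG}(V₊) ≅ k; consequently the kG-module V₊ is indecomposable. -/

import Mathlib

noncomputable section

open scoped TensorProduct

namespace SL2X

variable (p : ℕ) [Fact p.Prime]

/-- The algebraic closure of the prime field `𝔽_p`. -/
abbrev F : Type := AlgebraicClosure (ZMod p)

/-- `G = SL₂(F)`. -/
abbrev G : Type := Matrix.SpecialLinearGroup (Fin 2) (F p)

/-- The unipotent element `ε(x) = [[1,x],[0,1]]`. -/
def eps (x : F p) : G p :=
  ⟨!![1, x; 0, 1], by simp [Matrix.det_fin_two_of]⟩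

/-- The torus element `h(t) = diag(t, t⁻¹)`. -/
def h (t : (F p)ˣ) : G p :=
  ⟨!![(t : F p), 0; 0, ((t⁻¹ : (F p)ˣ) : F p)], by simp [Matrix.det_fin_two_of]⟩

/-- The Weyl element `s = [[0,1],[-1,0]]`. -/
def sG : G p :=
  ⟨!![0, 1; -1, 0], by simp [Matrix.det_fin_two_of]⟩

/-- The Borel subgroup `B` of upper triangular matrices in `G`. -/
def B : Subgroup (G p) where
  carrier := {g | (g : Matrix (Fin 2) (Fin 2) (F p)) 1 0 = 0}
  one_mem' := by simp [Matrix.one_apply]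
  mul_mem' := by
    intro a b ha hb
    simp only [Set.mem_setOf_eq] at *
    simp [Matrix.mul_apply, Fin.sum_univ_two, ha, hb]
  inv_mem' := by
    intro a ha
    simp only [Set.mem_setOf_eq] at *
    simp [Matrix.SpecialLinearGroup.coe_inv, Matrix.adjugate_fin_two, ha]

/-- The diagonal part of an element of `B`, as a unit of `F`. -/
def Bdiag (b : B p) : (F p)ˣ where
  val := ((b : G p) : Matrix (Fin 2) (Fin 2) (F p)) 0 0
  inv := ((b : G p) : Matrix (Fin 2) (Fin 2) (F p)) 1 1
  val_inv := by
    have hdet : ((b : G p) : Matrix (Fin 2) (Fin 2) (F p)).det = 1 := (b : G p).2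
    have h10 : ((b : G p) : Matrix (Fin 2) (Fin 2) (F p)) 1 0 = 0 := b.2
    rw [Matrix.det_fin_two, h10, mul_zero, sub_zero] at hdet
    exact hdet
  inv_val := by
    have hdet : ((b : G p) : Matrix (Fin 2) (Fin 2) (F p)).det = 1 := (b : G p).2
    have h10 : ((b : G p) : Matrix (Fin 2) (Fin 2) (F p)) 1 0 = 0 := b.2
    rw [Matrix.det_fin_two, h10, mul_zero, sub_zero] at hdet
    rw [mul_comm]; exact hdet

variable (k : Type) [Field k] [IsAlgClosed k] [CharZero k]

/-- The group algebra `kG`. -/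
abbrev kG : Type := MonoidAlgebra k (G p)

/-- The canonical image of a group element in the group algebra. -/
def γ (g : G p) : kG p k := MonoidAlgebra.of k (G p) g

/-- The submodule of relations defining the induced module
`M(θ) = kG ⊗_{kB} k_θ`, where the character `θ` of `T ≅ Fˣ` is extended to `B`
by letting `U` act trivially. -/
def Nmod (θ : (F p)ˣ →* kˣ) : Submodule (kG p k) (kG p k) :=
  Submodule.span (kG p k)
    {y | ∃ b : B p, y = γ p k (b : G p) - ((θ (Bdiag p b) : k)) • (1 : kG p k)}

/-- The induced module `M(θ) = kG ⊗_{kB} k_θ`, realized as `kG / N(θ)` where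
`N(θ)` is the left submodule generated by the elements `b - θ(b)·1`, `b ∈ B`. -/
def Mmod (θ : (F p)ˣ →* kˣ) : Type := kG p k ⧸ Nmod p k θ

instance (θ : (F p)ˣ →* kˣ) : AddCommGroup (Mmod p k θ) :=
  inferInstanceAs (AddCommGroup (kG p k ⧸ Nmod p k θ))
instance (θ : (F p)ˣ →* kˣ) : Module (kG p k) (Mmod p k θ) :=
  inferInstanceAs (Module (kG p k) (kG p k ⧸ Nmod p k θ))
instance (θ : (F p)ˣ →* kˣ) : Module k (Mmod p k θ) :=
  inferInstanceAs (Module k (kG p k ⧸ Nmod p k θ))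
instance (θ : (F p)ˣ →* kˣ) : IsScalarTower k (kG p k) (Mmod p k θ) :=
  inferInstanceAs (IsScalarTower k (kG p k) (kG p k ⧸ Nmod p k θ))

/-- The canonical generator `1_θ ∈ M(θ)`. -/
def oneθ (θ : (F p)ˣ →* kˣ) : Mmod p k θ :=
  Submodule.Quotient.mk (1 : kG p k)

/-- `η = (1 - s)·1_tr ∈ M(tr)`. -/
def eta : Mmod p k 1 :=
  Submodule.Quotient.mk ((1 : kG p k) - γ p k (sG p))

/-- The Steinberg module `St = kG·η ⊆ M(tr)`. -/
def St : Submodule (kG p k) (Mmod p k 1) :=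
  Submodule.span (kG p k) {eta p k}

/-- `ε(x)·η` as an element of `St`. -/
def E (x : F p) : ↥(St p k) :=
  ⟨γ p k (eps p x) • eta p k,
    Submodule.smul_mem _ _ (Submodule.mem_span_singleton_self _)⟩

/-- The action of a group element on `St`, as a `k`-linear map. -/
def gSt (g : G p) : ↥(St p k) →ₗ[k] ↥(St p k) where
  toFun v := ⟨γ p k g • (v : Mmod p k 1), Submodule.smul_mem _ _ v.2⟩
  map_add' := by intro a b; apply Subtype.ext; simp [smul_add]
  map_smul' := by
    intro c v; apply Subtype.ext
    simp [smul_comm (γ p k g) c]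

/-- `St ⊗_k St`. -/
abbrev StT : Type := ↥(St p k) ⊗[k] ↥(St p k)

/-- The diagonal action of a group element on `St ⊗_k St`. -/
def gTT (g : G p) : StT p k →ₗ[k] StT p k :=
  TensorProduct.map (gSt p k g) (gSt p k g)

/-- `ω_{x,y} = (ε(x)η ⊗ ε(y)η + ε(y)η ⊗ ε(x)η)/2`. -/
def ω (x y : F p) : StT p k :=
  (2 : k)⁻¹ • (E p k x ⊗ₜ[k] E p k y + E p k y ⊗ₜ[k] E p k x)

/-- `ρ_{x,y} = (ε(x)η ⊗ ε(y)η − ε(y)η ⊗ ε(x)η)/2`. -/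
def ρ (x y : F p) : StT p k :=
  (2 : k)⁻¹ • (E p k x ⊗ₜ[k] E p k y - E p k y ⊗ₜ[k] E p k x)

/-- `V₊`, the span of the `ω_{x,y}`. -/
def Vplus : Submodule k (StT p k) :=
  Submodule.span k {v | ∃ x y : F p, v = ω p k x y}

/-- `V₋`, the span of the `ρ_{x,y}` for `x ≠ y`. -/
def Vminus : Submodule k (StT p k) :=
  Submodule.span k {v | ∃ x y : F p, x ≠ y ∧ v = ρ p k x y}


lemma mul_val_apply (a b : G p) (i j : Fin 2) :
    (a * b).1 i j = a.1 i 0 * b.1 0 j + a.1 i 1 * b.1 1 j := by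
  change (a.1 * b.1) i j = _
  rw [Matrix.mul_apply, Fin.sum_univ_two]

lemma mul_sG_val_zero (g : G p) (i : Fin 2) : (g * sG p).1 i 0 = -g.1 i 1 := by
  rw [mul_val_apply]
  simp [sG]

lemma eps_zero : eps p 0 = 1 := by
  apply Subtype.ext
  simp [eps, Matrix.one_fin_two]

lemma γ_one : γ p k 1 = 1 := map_one _

lemma γ_mul (g g' : G p) : γ p k (g * g') = γ p k g * γ p k g' := map_mul _ _ _

/-- The image of `g` in `M(tr)` only depends on the line spanned by its first column. -/
lemma mk_γ_eq (g g' : G p) (hg : g.1 0 0 * g'.1 1 0 = g.1 1 0 * g'.1 0 0) :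
    (Submodule.Quotient.mk (γ p k g) : Mmod p k 1) = Submodule.Quotient.mk (γ p k g') := by
  have hB : g⁻¹ * g' ∈ B p := by
    change (g⁻¹ * g').1 1 0 = 0
    have h0 : (g⁻¹).1 1 0 = -g.1 1 0 := by
      change (Matrix.adjugate g.1) 1 0 = _
      simp [Matrix.adjugate_fin_two]
    have h1 : (g⁻¹).1 1 1 = g.1 0 0 := by
      change (Matrix.adjugate g.1) 1 1 = _
      simp [Matrix.adjugate_fin_two]
    rw [mul_val_apply, h0, h1]
    linear_combination hg
  symm
  refine (Submodule.Quotient.eq _).2 ?_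
  have h1 : γ p k (g⁻¹ * g') - (1 : kG p k) ∈ Nmod p k 1 :=
    Submodule.subset_span ⟨⟨_, hB⟩, by simp⟩
  have h2 := Submodule.smul_mem _ (γ p k g) h1
  rwa [smul_eq_mul, mul_sub, mul_one, ← γ_mul, mul_inv_cancel_left] at h2

lemma γ_smul_eta (g : G p) :
    γ p k g • eta p k =
      (Submodule.Quotient.mk (γ p k g) - Submodule.Quotient.mk (γ p k (g * sG p)) :
        Mmod p k 1) := by
  change Submodule.Quotient.mk (γ p k g • ((1 : kG p k) - γ p k (sG p))) = _
  rw [smul_eq_mul, mul_sub, mul_one, ← γ_mul]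
  rfl

lemma coe_E (x : F p) :
    (E p k x : Mmod p k 1) =
      (Submodule.Quotient.mk (γ p k 1) - Submodule.Quotient.mk (γ p k (eps p x * sG p)) :
        Mmod p k 1) := by
  have h1 : (Submodule.Quotient.mk (γ p k (eps p x)) : Mmod p k 1)
      = Submodule.Quotient.mk (γ p k 1) :=
    mk_γ_eq p k _ _ (by simp [eps])
  change γ p k (eps p x) • eta p k = _
  rw [γ_smul_eta, h1]

lemma gSt_h_E (t : (F p)ˣ) (x : F p) :
    gSt p k (h p t) (E p k x) = E p k ((t : F p) ^ 2 * x) := by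
  apply Subtype.ext
  change γ p k (h p t) • (γ p k (eps p x) • eta p k) = _
  rw [smul_smul, coe_E]
  rw [← γ_mul, γ_smul_eta]
  congr 1
  · apply mk_γ_eq
    rw [mul_val_apply, mul_val_apply]
    simp [eps, h]
  · apply mk_γ_eq
    have ht : (t : F p) ≠ 0 := t.ne_zero
    rw [mul_sG_val_zero, mul_sG_val_zero, mul_sG_val_zero, mul_sG_val_zero, mul_val_apply,
      mul_val_apply]
    simp [eps, h]
    field_simp

lemma coe_gSt_E_zero (g : G p) : (gSt p k g (E p k 0) : Mmod p k 1) = γ p k g • eta p k := by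
  change γ p k g • (γ p k (eps p 0) • eta p k) = _
  rw [eps_zero, γ_one, one_smul]

lemma gSt_eps_E_zero (x : F p) : gSt p k (eps p x) (E p k 0) = E p k x :=
  Subtype.ext (coe_gSt_E_zero p k _)

/-- `SL₂` acts transitively on pairs of distinct points of the affine line. -/
lemma exists_gSt_E_zero_eq_sub {x y : F p} (hxy : x ≠ y) :
    ∃ g : G p, gSt p k g (E p k 0) = E p k x - E p k y := by
  have hd : y - x ≠ 0 := sub_ne_zero.2 hxy.symm
  refine ⟨⟨!![y, x / (y - x); 1, 1 / (y - x)], ?_⟩, ?_⟩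
  · rw [Matrix.det_fin_two_of]
    field_simp
  set g : G p := ⟨!![y, x / (y - x); 1, 1 / (y - x)], _⟩ with hg
  apply Subtype.ext
  have hy : (Submodule.Quotient.mk (γ p k g) : Mmod p k 1)
      = Submodule.Quotient.mk (γ p k (eps p y * sG p)) := by
    apply mk_γ_eq
    rw [mul_sG_val_zero, mul_sG_val_zero]
    simp [hg, eps]
  have hx : (Submodule.Quotient.mk (γ p k (g * sG p)) : Mmod p k 1)
      = Submodule.Quotient.mk (γ p k (eps p x * sG p)) := by
    apply mk_γ_eq
    rw [mul_sG_val_zero, mul_sG_val_zero, mul_sG_val_zero, mul_sG_val_zero]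
    simp [hg, eps, div_eq_mul_inv, mul_comm]
  rw [coe_gSt_E_zero, γ_smul_eta, hy, hx, Submodule.coe_sub, coe_E, coe_E]
  exact (sub_sub_sub_cancel_left _ _ _).symm

open scoped Classical in
/-- The function on `kG` recording which finite point of the projective line `g · ∞` is. -/
def pointLift : kG p k →ₗ[k] (F p →₀ k) :=
  Finsupp.lift (F p →₀ k) k (G p)
      (fun g ↦ if g.1 1 0 = 0 then 0 else Finsupp.single (g.1 0 0 / g.1 1 0) 1) ∘ₗ
    (MonoidAlgebra.coeffLinearEquiv k).toLinearMap

open scoped Classical in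
lemma pointLift_γ (g : G p) :
    pointLift p k (γ p k g) =
      if g.1 1 0 = 0 then 0 else Finsupp.single (g.1 0 0 / g.1 1 0) 1 := by
  simp [pointLift, γ]

lemma pointLift_mul_B (g b : G p) (hb : b ∈ B p) :
    pointLift p k (γ p k (g * b)) = pointLift p k (γ p k g) := by
  have h10 : b.1 1 0 = 0 := hb
  have h00 : b.1 0 0 ≠ 0 := (Bdiag p ⟨b, hb⟩).ne_zero
  rw [pointLift_γ, pointLift_γ, mul_val_apply, mul_val_apply, h10, mul_zero, mul_zero,
    add_zero, add_zero, mul_div_mul_right _ _ h00]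
  by_cases hg : g.1 1 0 = 0
  · rw [if_pos hg, if_pos (mul_eq_zero_of_left hg _)]
  · rw [if_neg hg, if_neg (mul_ne_zero hg h00)]

lemma pointLift_Nmod (v : kG p k) (hv : v ∈ Nmod p k 1) : pointLift p k v = 0 := by
  have key : ∀ b ∈ B p, ∀ a : kG p k, pointLift p k (a * (γ p k b - 1)) = 0 := by
    intro b hb a
    induction a using MonoidAlgebra.induction_on with
    | of g =>
      change pointLift p k (γ p k g * (γ p k b - 1)) = 0
      rw [mul_sub, mul_one, ← γ_mul, map_sub, pointLift_mul_B p k g b hb, sub_self]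
    | add x y hx hy => rw [add_mul, map_add, hx, hy, add_zero]
    | smul r x hx => rw [smul_mul_assoc, map_smul, hx, smul_zero]
  have key' : ∀ a : kG p k, pointLift p k (a • v) = 0 := by
    induction hv using Submodule.span_induction with
    | mem v hv =>
      obtain ⟨⟨b, hb⟩, rfl⟩ := hv
      simpa using key b hb
    | zero => simp
    | add x y _ _ hx hy =>
      intro a
      rw [smul_add, map_add, hx, hy, add_zero]
    | smul r x _ hx =>
      intro a
      rw [smul_smul]
      exact hx _
  simpa using key' 1

/-- The descent of `pointLift` to `M(tr)`. -/
def pointMap : Mmod p k 1 →ₗ[k] (F p →₀ k) :=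
  ((Nmod p k 1).restrictScalars k).liftQ (pointLift p k) (pointLift_Nmod p k)

lemma pointMap_mk (v : kG p k) :
    pointMap p k (Submodule.Quotient.mk v) = pointLift p k v := rfl

/-- Coordinates on `St` with respect to the elements `E x`. -/
def coord : ↥(St p k) →ₗ[k] (F p →₀ k) :=
  -(pointMap p k ∘ₗ ((St p k).restrictScalars k).subtype)

lemma coord_E (x : F p) : coord p k (E p k x) = Finsupp.single x 1 := by
  change -(pointMap p k (E p k x : Mmod p k 1)) = _
  rw [coe_E]
  refine (congrArg Neg.neg (map_sub (pointMap p k) _ _)).trans ?_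
  rw [pointMap_mk, pointMap_mk, pointLift_γ, pointLift_γ, mul_sG_val_zero, mul_sG_val_zero]
  simp [eps]

/-- The elements `E x ⊗ E y`. -/
def EE (z : F p × F p) : StT p k := E p k z.1 ⊗ₜ[k] E p k z.2

lemma linearIndependent_EE : LinearIndependent k (EE p k) := by
  refine LinearIndependent.of_comp
    ((finsuppTensorFinsupp' k (F p) (F p)).toLinearMap ∘ₗ
      TensorProduct.map (coord p k) (coord p k)) ?_
  convert (Finsupp.basisSingleOne (R := k) (ι := F p × F p)).linearIndependent using 1
  ext1 z
  simp [EE, coord_E]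

lemma Vplus_le_range :
    Vplus p k ≤ LinearMap.range (Finsupp.linearCombination k (EE p k)) := by
  rw [Finsupp.range_linearCombination, Vplus, Submodule.span_le]
  rintro _ ⟨x, y, rfl⟩
  exact Submodule.smul_mem _ _ (Submodule.add_mem _ (Submodule.subset_span ⟨(x, y), rfl⟩)
    (Submodule.subset_span ⟨(y, x), rfl⟩))

lemma gTT_h_EE (t : (F p)ˣ) (z : F p × F p) :
    gTT p k (h p t) (EE p k z) = EE p k (((t : F p) ^ 2) • z) := by
  simp [gTT, EE, gSt_h_E]

/-- A finitely supported function on the plane invariant under all homotheties is supported at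
the origin. -/
lemma eq_single_of_invariant {K R : Type*} [Field K] [Infinite K] [IsAlgClosed K] [Zero R]
    (c : K × K →₀ R) (hc : ∀ (t : Kˣ) z, c ((t : K) ^ 2 • z) = c z) :
    c = Finsupp.single 0 (c 0) := by
  classical
  ext z
  by_cases hz : z = 0
  · simp [hz]
  rw [Finsupp.single_eq_of_ne hz]
  by_contra hcz
  have key : ∀ w : K, w ≠ 0 → w • z ∈ c.support := by
    intro w hw
    obtain ⟨t, ht⟩ := IsAlgClosed.exists_pow_nat_eq w (n := 2) (by norm_num)
    have ht0 : t ≠ 0 := by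
      rintro rfl
      exact hw (by simpa using ht.symm)
    have := hc (Units.mk0 t ht0) z
    rw [Units.val_mk0, ht] at this
    rw [Finsupp.mem_support_iff, this]
    exact hcz
  have hinj : Function.Injective fun w : K ↦ w • z := smul_left_injective K hz
  have hfin : ({0}ᶜ : Set K).Finite :=
    (c.support.finite_toSet.preimage hinj.injOn).subset fun w hw ↦ key w hw
  exact (Set.finite_singleton (0 : K)).infinite_compl hfin

/-- A torus-invariant vector of `V₊` is a multiple of `η ⊗ η`. -/
lemma eq_smul_of_torus_invariant (v : StT p k) (hv : v ∈ Vplus p k)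
    (hfix : ∀ t, gTT p k (h p t) v = v) : ∃ c : k, v = c • EE p k 0 := by
  obtain ⟨c, rfl⟩ := Vplus_le_range p k hv
  have hc : ∀ (t : (F p)ˣ) z, c ((t : F p) ^ 2 • z) = c z := by
    intro t z
    have ht : (t : F p) ^ 2 ≠ 0 := pow_ne_zero _ t.ne_zero
    have h1 : c.mapDomain (fun z ↦ (t : F p) ^ 2 • z) = c := by
      apply linearIndependent_EE p k
      rw [Finsupp.linearCombination_mapDomain, ← hfix t]
      simp only [Finsupp.linearCombination_apply, Finsupp.sum, map_sum, map_smul, gTT_h_EE,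
        Function.comp_apply]
    conv_lhs => rw [← h1]
    exact Finsupp.mapDomain_apply (smul_right_injective _ ht) c z
  have : Infinite (F p) := IsAlgClosed.instInfinite
  refine ⟨c 0, ?_⟩
  conv_lhs => rw [eq_single_of_invariant c hc]
  simp

lemma EE_zero_mem : EE p k 0 ∈ Vplus p k := by
  refine Submodule.subset_span ⟨0, 0, ?_⟩
  simp only [ω, EE, Prod.fst_zero, Prod.snd_zero]
  rw [← two_smul k, smul_smul, inv_mul_cancel₀ two_ne_zero, one_smul]

/-- `η ⊗ η` generates `V₊`. -/
lemma Vplus_le_span_orbit :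
    Vplus p k ≤ Submodule.span k (Set.range fun g ↦ gTT p k g (EE p k 0)) := by
  rw [Vplus, Submodule.span_le]
  have hdiag : ∀ x, E p k x ⊗ₜ[k] E p k x ∈
      Submodule.span k (Set.range fun g ↦ gTT p k g (EE p k 0)) := fun x ↦
    Submodule.subset_span ⟨eps p x, by simp [gTT, EE, gSt_eps_E_zero]⟩
  have hdiff : ∀ x y, (E p k x - E p k y) ⊗ₜ[k] (E p k x - E p k y) ∈
      Submodule.span k (Set.range fun g ↦ gTT p k g (EE p k 0)) := by
    intro x y
    rcases eq_or_ne x y with rfl | hxy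
    · simp
    · obtain ⟨g, hg⟩ := exists_gSt_E_zero_eq_sub p k hxy
      exact Submodule.subset_span ⟨g, by simp [gTT, EE, hg]⟩
  rintro _ ⟨x, y, rfl⟩
  have : ω p k x y = (2 : k)⁻¹ • (E p k x ⊗ₜ[k] E p k x + E p k y ⊗ₜ[k] E p k y
      + (-1 : k) • ((E p k x - E p k y) ⊗ₜ[k] (E p k x - E p k y))) := by
    rw [ω]
    congr 1
    obtain ⟨d, hd⟩ : ∃ d, E p k x = E p k y + d := ⟨E p k x - E p k y, by abel⟩
    rw [hd, add_sub_cancel_left]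
    simp only [TensorProduct.add_tmul, TensorProduct.tmul_add]
    module
  rw [SetLike.mem_coe, this]
  exact Submodule.smul_mem _ _ (Submodule.add_mem _ (Submodule.add_mem _ (hdiag x) (hdiag y))
    (Submodule.smul_mem _ _ (hdiff x y)))

lemma exists_projection_of_inf_eq_bot {K V : Type*} [Ring K] [AddCommMonoid V] [Module K V]
    {W₁ W₂ U : Submodule K V} (hsup : W₁ ⊔ W₂ = U) (hinf : W₁ ⊓ W₂ = ⊥) :
    ∃ π : ↥U →ₗ[K] ↥U, ∀ a ∈ W₁, ∀ b ∈ W₂, ∀ hv : a + b ∈ U, (π ⟨a + b, hv⟩ : V) = a := by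
  letI : AddCommGroup V := Module.addCommMonoidToAddCommGroup K
  have hle₁ : W₁ ≤ U := hsup ▸ le_sup_left
  have hle₂ : W₂ ≤ U := hsup ▸ le_sup_right
  have hcompl : IsCompl (W₁.submoduleOf U) (W₂.submoduleOf U) := by
    constructor
    · rw [Submodule.disjoint_def]
      rintro ⟨v, hv⟩ hv₁ hv₂
      exact Subtype.ext ((Submodule.mem_bot K).1 (hinf ▸ Submodule.mem_inf.2 ⟨hv₁, hv₂⟩))
    · rw [codisjoint_iff, eq_top_iff]
      rintro ⟨v, hv⟩ -
      obtain ⟨a, ha, b, hb, rfl⟩ := Submodule.mem_sup.1 (hsup ▸ hv)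
      exact Submodule.mem_sup.2 ⟨⟨a, hle₁ ha⟩, ha, ⟨b, hle₂ hb⟩, hb, rfl⟩
  refine ⟨Submodule.projection _ _ hcompl, fun a ha b hb hv ↦ ?_⟩
  have h1 : (⟨a + b, hv⟩ : U) = ⟨a, hle₁ ha⟩ + ⟨b, hle₂ hb⟩ := rfl
  have h2 : Submodule.projection _ _ hcompl ⟨a, hle₁ ha⟩ = ⟨a, hle₁ ha⟩ :=
    Submodule.projection_apply_left hcompl ⟨⟨a, hle₁ ha⟩, ha⟩
  have h3 : Submodule.projection _ _ hcompl ⟨b, hle₂ hb⟩ = 0 :=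
    (Submodule.projection_apply_eq_zero_iff hcompl).2 hb
  rw [h1, map_add, h2, h3, add_zero]

lemma endomorphism_eq_smul
    (hstab : ∀ (g : G p) (v : StT p k), v ∈ Vplus p k → gTT p k g v ∈ Vplus p k)
    (φ : ↥(Vplus p k) →ₗ[k] ↥(Vplus p k))
    (hφ : ∀ (g : G p) (v : ↥(Vplus p k)),
      (φ ⟨gTT p k g (v : StT p k), hstab g v v.2⟩ : StT p k) = gTT p k g (φ v : StT p k)) :
    ∃ c : k, ∀ v, φ v = c • v := by
  obtain ⟨c, hc⟩ := eq_smul_of_torus_invariant p k (φ ⟨EE p k 0, EE_zero_mem p k⟩)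
    (Subtype.property _) (fun t ↦ by
      rw [← hφ]
      congr 3
      simp [gTT_h_EE])
  refine ⟨c, ?_⟩
  rintro ⟨v, hv⟩
  have key : ∀ w ∈ Submodule.span k (Set.range fun g ↦ gTT p k g (EE p k 0)),
      ∀ hw : w ∈ Vplus p k, (φ ⟨w, hw⟩ : StT p k) = c • w := by
    intro w hw
    suffices H : ∃ hw : w ∈ Vplus p k, (φ ⟨w, hw⟩ : StT p k) = c • w from fun _ ↦ H.2
    induction hw using Submodule.span_induction with
    | mem w hw =>
      obtain ⟨g, rfl⟩ := hw
      exact ⟨hstab g _ (EE_zero_mem p k), by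
        rw [hφ g ⟨EE p k 0, EE_zero_mem p k⟩, hc, map_smul]⟩
    | zero => exact ⟨Submodule.zero_mem _, by
      rw [smul_zero]
      exact congrArg Subtype.val (map_zero φ)⟩
    | add x y _ _ hx hy =>
      obtain ⟨hx, hx'⟩ := hx
      obtain ⟨hy, hy'⟩ := hy
      refine ⟨Submodule.add_mem _ hx hy, ?_⟩
      rw [smul_add, ← hx', ← hy', ← Submodule.coe_add, ← map_add]
      rfl
    | smul a x _ hx =>
      obtain ⟨hx, hx'⟩ := hx
      refine ⟨Submodule.smul_mem _ a hx, ?_⟩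
      rw [smul_comm, ← hx', ← Submodule.coe_smul, ← map_smul]
      rfl
  exact Subtype.ext (key v (Vplus_le_span_orbit p k hv) hv)

/-- every `kG`-endomorphism of `V₊` is a scalar; consequently `V₊`
is indecomposable as a `kG`-module. -/
theorem stmt7 (hp2 : p ≠ 2)
    (hstab : ∀ (g : G p) (v : StT p k), v ∈ Vplus p k → gTT p k g v ∈ Vplus p k) :
    (∀ φ : ↥(Vplus p k) →ₗ[k] ↥(Vplus p k),
      (∀ (g : G p) (v : ↥(Vplus p k)),
        (φ ⟨gTT p k g (v : StT p k), hstab g v v.2⟩ : StT p k) = gTT p k g (φ v : StT p k)) →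
      ∃ c : k, ∀ v, φ v = c • v) ∧
    (∀ W₁ W₂ : Submodule k (StT p k),
      (∀ (g : G p) (v : StT p k), v ∈ W₁ → gTT p k g v ∈ W₁) →
      (∀ (g : G p) (v : StT p k), v ∈ W₂ → gTT p k g v ∈ W₂) →
      W₁ ⊔ W₂ = Vplus p k → W₁ ⊓ W₂ = ⊥ → W₁ = ⊥ ∨ W₂ = ⊥) := by
  refine ⟨fun φ hφ ↦ endomorphism_eq_smul p k hstab φ hφ, ?_⟩
  intro W₁ W₂ h₁ h₂ hsup hinf
  have hle₁ : W₁ ≤ Vplus p k := hsup ▸ le_sup_left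
  have hle₂ : W₂ ≤ Vplus p k := hsup ▸ le_sup_right
  obtain ⟨π, hπ⟩ := exists_projection_of_inf_eq_bot hsup hinf
  obtain ⟨c, hc⟩ := endomorphism_eq_smul p k hstab π (by
    rintro g ⟨v, hv⟩
    obtain ⟨a, ha, b, hb, rfl⟩ := Submodule.mem_sup.1 (hsup ▸ hv)
    rw [hπ a ha b hb]
    have := hπ _ (h₁ g a ha) _ (h₂ g b hb) (by rw [← map_add]; exact hstab g _ hv)
    simp only [map_add]
    exact this)
  rcases eq_or_ne c 0 with rfl | hc0
  · left
    refine (Submodule.eq_bot_iff _).2 fun a ha ↦ ?_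
    have := hπ a ha 0 (Submodule.zero_mem _) (by rw [add_zero]; exact hle₁ ha)
    rw [hc, zero_smul] at this
    exact this.symm
  · right
    refine (Submodule.eq_bot_iff _).2 fun b hb ↦ ?_
    have h0 := hπ 0 (Submodule.zero_mem _) b hb (by rw [zero_add]; exact hle₂ hb)
    rw [hc, Submodule.coe_smul] at h0
    have h1 : c • b = 0 := by simpa only [zero_add] using h0
    rw [← inv_smul_smul₀ hc0 b, h1, smul_zero]

end SL2X
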